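/- Let N ≥ 1. There exists a constant C > 0 depending only on N such that for all x, y, η ∈ ℝ^N and all 0 < s < t, G(y − (s/t)x − ((t−s)/t)η, 2s(t−s)/t) · e^{−|x−y|²/(8(t−s))} ≤ C (G(y−η, 35s) + G(y−x, 35(t−s))). -/

import Mathlib

open MeasureTheory Real Set

noncomputable def heatKernel (N : ℕ) (x : EuclideanSpace ℝ (Fin N)) (t : ℝ) : ℝ :=
  (4 * Real.pi * t) ^ (-(N : ℝ) / 2) * Real.exp (-‖x‖ ^ 2 / (4 * t))

lemma heatKernel_nonneg (N : ℕ) (x : EuclideanSpace ℝ (Fin N)) {t : ℝ} (ht : 0 < t) :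
    0 ≤ heatKernel N x t := by
  unfold heatKernel
  positivity

/-- Comparison of a damped heat kernel with one at a later time, up to a dimensional constant. -/
lemma heatKernel_mul_exp_le (N : ℕ) (z w : EuclideanSpace ℝ (Fin N)) {c r σ e : ℝ}
    (hc : 0 < c) (hr : 0 < r) (hrσ : r ≤ σ)
    (h : ‖w‖ ^ 2 / (4 * (c * r)) ≤ ‖z‖ ^ 2 / (4 * σ) - e) :
    heatKernel N z σ * Real.exp e ≤ c ^ ((N : ℝ) / 2) * heatKernel N w (c * r) := by
  have hscale : c ^ ((N : ℝ) / 2) * (4 * Real.pi * (c * r)) ^ (-(N : ℝ) / 2)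
      = (4 * Real.pi * r) ^ (-(N : ℝ) / 2) := by
    rw [show 4 * Real.pi * (c * r) = c * (4 * Real.pi * r) by ring,
      Real.mul_rpow hc.le (by positivity), ← mul_assoc, ← Real.rpow_add hc]
    rw [show (N : ℝ) / 2 + -(N : ℝ) / 2 = 0 by ring, Real.rpow_zero, one_mul]
  unfold heatKernel
  rw [← mul_assoc, hscale, mul_assoc, ← Real.exp_add]
  refine mul_le_mul ?_ ?_ (Real.exp_pos _).le (by positivity)
  · refine Real.rpow_le_rpow_of_nonpos (by positivity) (by gcongr) ?_
    have : (0 : ℝ) ≤ N := N.cast_nonneg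
    linarith
  · refine Real.exp_le_exp.mpr ?_
    rw [neg_div, neg_div]
    linarith

theorem statement10 (N : ℕ) (hN : 1 ≤ N) :
    ∃ C : ℝ, 0 < C ∧
      ∀ (x y η : EuclideanSpace ℝ (Fin N)) (s t : ℝ), 0 < s → s < t →
        heatKernel N (y - (s / t) • x - ((t - s) / t) • η) (2 * (s * (t - s) / t)) *
            Real.exp (-‖x - y‖ ^ 2 / (8 * (t - s)))
          ≤ C * (heatKernel N (y - η) (35 * s) + heatKernel N (y - x) (35 * (t - s))) := by
  refine ⟨35 ^ ((N : ℝ) / 2), by positivity, fun x y η s t hs hst => ?_⟩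
  obtain ⟨τ, rfl⟩ : ∃ τ, t = s + τ := ⟨t - s, by ring⟩
  have hτ : 0 < τ := by linarith
  rw [add_sub_cancel_left]
  have ht : 0 < s + τ := by positivity
  set z := y - (s / (s + τ)) • x - (τ / (s + τ)) • η with hz
  rw [norm_sub_rev x y, mul_add]
  have h1 := heatKernel_nonneg N (y - η) (t := 35 * s) (by positivity)
  have h2 := heatKernel_nonneg N (y - x) (t := 35 * τ) (by positivity)
  have hC : (0 : ℝ) ≤ 35 ^ ((N : ℝ) / 2) := by positivity
  rcases le_total s τ with hle | hle
  · refine le_trans ?_ (le_add_of_nonneg_right (mul_nonneg hC h2))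
    refine heatKernel_mul_exp_le N z (y - η) (by norm_num) hs ?_ ?_
    · rw [← mul_div_assoc, le_div_iff₀ ht]
      nlinarith
    · have hb : τ • (y - η) = (s + τ) • z - s • (y - x) := by
        simp only [hz, smul_sub, smul_smul, mul_div_cancel₀ _ ht.ne', add_smul]
        abel
      have hn : τ * ‖y - η‖ ≤ (s + τ) * ‖z‖ + s * ‖y - x‖ := by
        have := norm_sub_le ((s + τ) • z) (s • (y - x))
        rwa [← hb, norm_smul, norm_smul, norm_smul, Real.norm_of_nonneg hτ.le,
          Real.norm_of_nonneg ht.le, Real.norm_of_nonneg hs.le] at this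
      have hsq : (τ * ‖y - η‖) ^ 2
          ≤ 2 * ((s + τ) * ‖z‖) ^ 2 + 2 * (s * ‖y - x‖) ^ 2 := by
        have : (τ * ‖y - η‖) ^ 2 ≤ ((s + τ) * ‖z‖ + s * ‖y - x‖) ^ 2 := by gcongr
        nlinarith [sq_nonneg ((s + τ) * ‖z‖ - s * ‖y - x‖)]
      have e : ‖z‖ ^ 2 / (4 * (2 * (s * τ / (s + τ)))) - -‖y - x‖ ^ 2 / (8 * τ)
          = (τ * (s + τ) * ‖z‖ ^ 2 + s * τ * ‖y - x‖ ^ 2) / (8 * s * τ ^ 2) := by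
        field_simp
        ring
      have e' : ‖y - η‖ ^ 2 / (4 * (35 * s))
          = (τ * ‖y - η‖) ^ 2 * (2 / 35) / (8 * s * τ ^ 2) := by
        field_simp
        ring
      rw [e, e']
      gcongr
      have hA : (s + τ) ^ 2 * ‖z‖ ^ 2 ≤ 2 * (τ * (s + τ) * ‖z‖ ^ 2) := by
        have : (s + τ) ^ 2 ≤ 2 * (τ * (s + τ)) := by nlinarith
        nlinarith [sq_nonneg ‖z‖]
      have hB : s ^ 2 * ‖y - x‖ ^ 2 ≤ s * τ * ‖y - x‖ ^ 2 := by
        have : s ^ 2 ≤ s * τ := by nlinarith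
        gcongr
      have hA0 : 0 ≤ τ * (s + τ) * ‖z‖ ^ 2 := by positivity
      have hB0 : 0 ≤ s * τ * ‖y - x‖ ^ 2 := by positivity
      rw [mul_pow (s + τ), mul_pow s] at hsq
      linarith
  · refine le_trans ?_ (le_add_of_nonneg_left (mul_nonneg hC h1))
    refine heatKernel_mul_exp_le N z (y - x) (by norm_num) hτ ?_ ?_
    · rw [← mul_div_assoc, le_div_iff₀ ht]
      nlinarith
    · have hz0 : 0 ≤ ‖z‖ ^ 2 / (4 * (2 * (s * τ / (s + τ)))) := by positivity
      have : ‖y - x‖ ^ 2 / (4 * (35 * τ)) ≤ ‖y - x‖ ^ 2 / (8 * τ) := by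
        refine div_le_div_of_nonneg_left (by positivity) (by positivity) ?_
        linarith
      rw [neg_div]
      linarith
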